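/- arXiv:2410.12401 — 7 statements merged into one kernel-verified Lean document; each statement's English description precedes it below -/
import Mathlib

section
/- On a directed path with n vertices, nonnegative edge costs, nonnegative profits and finitely many time windows per vertex, for 1 ≤ i ≤ n and every real t ≥ D_i let Π_i(t) denote the maximum profit of a timed walk starting at v_1 at time 0 whose last entry is (v_i, a_i, t), i.e., which ends at v_i with departure time t. Then Π_i is nondecreasing: for all D_i ≤ t ≤ t' one has Π_i(t) ≤ Π_i(t'). -/
open scoped Classical

/-- A timed walk on the directed path `v_1, …, v_n`, starting at `v_1` at time `0`.
`c i` is the cost of the directed edge from `v_{i-1}` to `v_i` (for `2 ≤ i ≤ n`).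
The walk arrives at `v_k` at time `a k` and departs (is last present) at time `b k`;
it ends at vertex `v_q`. -/
structure PathWalk (n : ℕ) (c : ℕ → ℝ) where
  q : ℕ
  hq1 : 1 ≤ q
  hqn : q ≤ n
  a : ℕ → ℝ
  b : ℕ → ℝ
  ha1 : a 1 = 0
  hab : ∀ k, 1 ≤ k → k ≤ q → a k ≤ b k
  hstep : ∀ k, 1 ≤ k → k < q → a (k + 1) = b k + c (k + 1)

/-- The walk `w` collects vertex `v_i`, where `W i` is the (finite) set of
time windows `(r, d)` of vertex `v_i`: the walk reaches `v_i` and its presence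
interval `[a i, b i]` intersects some window of `v_i`. -/
def PathWalk.collects {n : ℕ} {c : ℕ → ℝ} (w : PathWalk n c)
    (W : ℕ → Finset (ℝ × ℝ)) (i : ℕ) : Prop :=
  i ≤ w.q ∧ ∃ rd ∈ W i, w.a i ≤ rd.2 ∧ rd.1 ≤ w.b i

/-- The profit of a timed walk: the sum of profits over all collected vertices. -/
noncomputable def PathWalk.profit {n : ℕ} {c : ℕ → ℝ} (w : PathWalk n c)
    (W : ℕ → Finset (ℝ × ℝ)) (π : ℕ → ℝ) : ℝ :=
  ∑ i ∈ Finset.Icc 1 n, if w.collects W i then π i else 0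

/-- `maxProfit n c W π i t` : the maximum profit `Π_i(t)` of a timed walk starting at
`v_1` at time `0` whose last entry is `(v_i, a_i, t)`. -/
noncomputable def maxProfit (n : ℕ) (c : ℕ → ℝ) (W : ℕ → Finset (ℝ × ℝ))
    (π : ℕ → ℝ) (i : ℕ) (t : ℝ) : ℝ :=
  sSup {p | ∃ w : PathWalk n c, w.q = i ∧ w.b i = t ∧ p = w.profit W π}

/-- The walk with its final departure delayed to a later time. -/
noncomputable def PathWalk.extend {n : ℕ} {c : ℕ → ℝ} (w : PathWalk n c) (t' : ℝ)
    (h : w.b w.q ≤ t') : PathWalk n c where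
  q := w.q
  hq1 := w.hq1
  hqn := w.hqn
  a := w.a
  b := Function.update w.b w.q t'
  ha1 := w.ha1
  hab k hk hkq := by
    rcases eq_or_ne k w.q with rfl | hne
    · simpa using (w.hab _ hk hkq).trans h
    · simpa [hne] using w.hab k hk hkq
  hstep k hk hkq := by
    simpa [hkq.ne] using w.hstep k hk hkq

theorem PathWalk.collects.extend {n : ℕ} {c : ℕ → ℝ} {w : PathWalk n c}
    {W : ℕ → Finset (ℝ × ℝ)} {i : ℕ} (hw : w.collects W i) {t' : ℝ} (h : w.b w.q ≤ t') :
    (w.extend t' h).collects W i := by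
  obtain ⟨hi, rd, hrd, ha, hb⟩ := hw
  refine ⟨hi, rd, hrd, ha, hb.trans ?_⟩
  rcases eq_or_ne i w.q with rfl | hne
  · simpa [PathWalk.extend] using h
  · simp [PathWalk.extend, hne]

theorem PathWalk.profit_nonneg {n : ℕ} {c : ℕ → ℝ} (w : PathWalk n c)
    (W : ℕ → Finset (ℝ × ℝ)) {π : ℕ → ℝ} (hπ : ∀ i, 0 ≤ π i) : 0 ≤ w.profit W π :=
  Finset.sum_nonneg fun i _ => by split_ifs <;> simp [hπ i]

theorem PathWalk.profit_le_sum {n : ℕ} {c : ℕ → ℝ} (w : PathWalk n c)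
    (W : ℕ → Finset (ℝ × ℝ)) {π : ℕ → ℝ} (hπ : ∀ i, 0 ≤ π i) :
    w.profit W π ≤ ∑ i ∈ Finset.Icc 1 n, π i :=
  Finset.sum_le_sum fun i _ => by split_ifs <;> simp [hπ i]

theorem PathWalk.profit_le_profit_extend {n : ℕ} {c : ℕ → ℝ} (w : PathWalk n c)
    (W : ℕ → Finset (ℝ × ℝ)) {π : ℕ → ℝ} (hπ : ∀ i, 0 ≤ π i) {t' : ℝ} (h : w.b w.q ≤ t') :
    w.profit W π ≤ (w.extend t' h).profit W π := by
  refine Finset.sum_le_sum fun i _ => ?_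
  by_cases hw : w.collects W i
  · rw [if_pos hw, if_pos (hw.extend h)]
  · rw [if_neg hw]
    split_ifs <;> simp [hπ i]

/-- On a directed path, the maximum profit `Π_i(t)` of a walk ending at `v_i` with
departure time `t` is nondecreasing in `t` (for `t ≥ D_i`). -/
theorem stmt0 (n : ℕ) (hn : 1 ≤ n) (c : ℕ → ℝ) (hc : ∀ i, 0 ≤ c i)
    (π : ℕ → ℝ) (hπ : ∀ i, 0 ≤ π i)
    (W : ℕ → Finset (ℝ × ℝ)) (hW : ∀ i, ∀ rd ∈ W i, 0 ≤ rd.1 ∧ rd.1 ≤ rd.2)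
    (i : ℕ) (hi1 : 1 ≤ i) (hin : i ≤ n) (t t' : ℝ)
    (ht : ∑ k ∈ Finset.Icc 2 i, c k ≤ t) (htt' : t ≤ t') :
    maxProfit n c W π i t ≤ maxProfit n c W π i t' := by
  apply Real.sSup_le
  · rintro _ ⟨w, rfl, rfl, rfl⟩
    refine (w.profit_le_profit_extend W hπ htt').trans (le_csSup ?_ ?_)
    · refine ⟨∑ j ∈ Finset.Icc 1 n, π j, ?_⟩
      rintro _ ⟨w', -, -, rfl⟩
      exact w'.profit_le_sum W hπ
    · exact ⟨w.extend t' htt', rfl, by simp [PathWalk.extend], rfl⟩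
  · apply Real.sSup_nonneg
    rintro _ ⟨w, -, -, rfl⟩
    exact w.profit_nonneg W hπ
end

section
/- On a directed path with n vertices, nonnegative edge costs, nonnegative profits and finitely many time windows per vertex, let Π_i(t) (for t ≥ D_i) denote the maximum profit of a timed walk starting at v_1 at time 0 ending at v_i with departure time t. Then for 2 ≤ i ≤ n and t ≥ D_i: (a) if t lies in some window of v_i, then Π_i(t) = Π_{i−1}(t − c_i) + π(v_i); (b) otherwise, if d* denotes the largest right endpoint (deadline) of a window of v_i with d* < t and such a d* exists with d* ≥ D_i, then Π_i(t) = max(Π_{i−1}(t − c_i), Π_i(d*)); (c) otherwise Π_i(t) = Π_{i−1}(t − c_i). -/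
open scoped Classical

namespace PathWalk

variable {n : ℕ} {c : ℕ → ℝ} (w : PathWalk n c) (W : ℕ → Finset (ℝ × ℝ)) (π : ℕ → ℝ)

/-- Profit can be summed over the visited vertices only. -/
theorem profit_eq_sum_visited :
    w.profit W π = ∑ k ∈ Finset.Icc 1 w.q,
      if ∃ rd ∈ W k, w.a k ≤ rd.2 ∧ rd.1 ≤ w.b k then π k else 0 := by
  unfold profit
  symm
  rw [← Finset.sum_subset (Finset.Icc_subset_Icc_right w.hqn)]
  · refine Finset.sum_congr rfl fun k hk => ?_
    simp [collects, (Finset.mem_Icc.mp hk).2]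
  · intro k hk hkq
    have : ¬ k ≤ w.q := fun h => hkq (Finset.mem_Icc.mpr ⟨(Finset.mem_Icc.mp hk).1, h⟩)
    simp [collects, this]

theorem profit_le_sum_s1 (hπ : ∀ k, 0 ≤ π k) :
    w.profit W π ≤ ∑ k ∈ Finset.Icc 1 n, π k := by
  refine Finset.sum_le_sum fun k _ => ?_
  split_ifs
  · exact le_rfl
  · exact hπ k

/-- No walk arrives at a vertex before its distance from the start. -/
theorem dist_le_arrival (k : ℕ) (hk1 : 1 ≤ k) (hkq : k ≤ w.q) :
    ∑ l ∈ Finset.Icc 2 k, c l ≤ w.a k := by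
  induction k, hk1 using Nat.le_induction with
  | base => simp [w.ha1]
  | succ k hk ih =>
    have h1 := ih (by omega)
    have h2 := w.hab k hk (by omega)
    rw [Finset.sum_Icc_succ_top (by omega), w.hstep k hk (by omega)]
    linarith

/-- Change the departure time from the last vertex. -/
noncomputable def setDeparture (t : ℝ) (ht : w.a w.q ≤ t) : PathWalk n c where
  q := w.q
  hq1 := w.hq1
  hqn := w.hqn
  a := w.a
  b := Function.update w.b w.q t
  ha1 := w.ha1
  hab k h1 h2 := by
    rcases eq_or_ne k w.q with rfl | h
    · simpa using ht
    · simpa [h] using w.hab k h1 h2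
  hstep k h1 h2 := by
    simpa [h2.ne] using w.hstep k h1 h2

/-- Leaving the last vertex at another time does not decrease the profit, provided that the
last vertex stays collected. -/
theorem profit_le_profit_setDeparture (hπ : ∀ k, 0 ≤ π k) (t : ℝ) (ht : w.a w.q ≤ t)
    (h : ∀ rd ∈ W w.q, w.a w.q ≤ rd.2 → rd.1 ≤ w.b w.q → rd.1 ≤ t) :
    w.profit W π ≤ (w.setDeparture t ht).profit W π := by
  refine Finset.sum_le_sum fun k _ => ?_
  by_cases hk : w.collects W k
  · have hk' : (w.setDeparture t ht).collects W k := by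
      obtain ⟨hkq, rd, hrd, h1, h2⟩ := hk
      refine ⟨hkq, rd, hrd, h1, ?_⟩
      rcases eq_or_ne k w.q with rfl | hne
      · simpa [setDeparture] using h rd hrd h1 h2
      · simpa [setDeparture, hne] using h2
    simp [hk, hk']
  · rw [if_neg hk]
    split_ifs
    · exact hπ k
    · exact le_rfl

/-- Continue a walk along the next edge, leaving the new vertex at time `t`. -/
noncomputable def extend_s1 (hq : w.q + 1 ≤ n) (t : ℝ) (ht : w.b w.q + c (w.q + 1) ≤ t) :
    PathWalk n c where
  q := w.q + 1
  hq1 := by omega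
  hqn := hq
  a := Function.update w.a (w.q + 1) (w.b w.q + c (w.q + 1))
  b := Function.update w.b (w.q + 1) t
  ha1 := by
    have := w.hq1
    rw [Function.update_of_ne (by omega), w.ha1]
  hab k h1 h2 := by
    rcases eq_or_ne k (w.q + 1) with rfl | h
    · simpa using ht
    · simpa [h] using w.hab k h1 (by omega)
  hstep k h1 h2 := by
    rw [Function.update_of_ne (by omega : k ≠ w.q + 1)]
    rcases eq_or_ne k w.q with rfl | h
    · simp
    · rw [Function.update_of_ne (by omega)]
      exact w.hstep k h1 (by omega)

theorem profit_extend (hq : w.q + 1 ≤ n) (t : ℝ) (ht : w.b w.q + c (w.q + 1) ≤ t) :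
    (w.extend_s1 hq t ht).profit W π = w.profit W π +
      if ∃ rd ∈ W (w.q + 1), w.b w.q + c (w.q + 1) ≤ rd.2 ∧ rd.1 ≤ t
        then π (w.q + 1) else 0 := by
  rw [profit_eq_sum_visited, profit_eq_sum_visited]
  change ∑ k ∈ Finset.Icc 1 (w.q + 1), _ = _
  rw [Finset.sum_Icc_succ_top (by omega)]
  congr 1
  · refine Finset.sum_congr rfl fun k hk => ?_
    have : k ≠ w.q + 1 := by
      have := (Finset.mem_Icc.mp hk).2
      omega
    simp [extend_s1, this]
  · simp [extend_s1]

/-- Drop the vertices after `v_j`. -/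
def truncate (j : ℕ) (h1 : 1 ≤ j) (hj : j ≤ w.q) : PathWalk n c where
  q := j
  hq1 := h1
  hqn := hj.trans w.hqn
  a := w.a
  b := w.b
  ha1 := w.ha1
  hab k hk hkj := w.hab k hk (hkj.trans hj)
  hstep k hk hkj := w.hstep k hk (hkj.trans_le hj)

theorem profit_eq_profit_truncate_add (j : ℕ) (h1 : 1 ≤ j) (hj : w.q = j + 1) :
    w.profit W π = (w.truncate j h1 (by omega)).profit W π +
      if ∃ rd ∈ W (j + 1), w.a (j + 1) ≤ rd.2 ∧ rd.1 ≤ w.b (j + 1) then π (j + 1) else 0 := by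
  have hsum := w.profit_eq_sum_visited W π
  rw [hj, Finset.sum_Icc_succ_top (by omega)] at hsum
  rw [hsum, profit_eq_sum_visited]
  rfl

/-- Every vertex can be left at every time from its distance on. -/
theorem exists_departure (i : ℕ) (h1 : 1 ≤ i) (hin : i ≤ n) (t : ℝ)
    (ht : ∑ l ∈ Finset.Icc 2 i, c l ≤ t) : ∃ w : PathWalk n c, w.q = i ∧ w.b i = t := by
  induction i, h1 using Nat.le_induction generalizing t with
  | base =>
    refine ⟨⟨1, le_rfl, hin, fun _ => 0, fun _ => t, rfl, fun k _ _ => ?_, fun k _ _ => ?_⟩,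
      rfl, rfl⟩
    · simpa using ht
    · omega
  | succ j hj ih =>
    rw [Finset.sum_Icc_succ_top (by omega)] at ht
    obtain ⟨w, rfl, hb⟩ := ih (by omega) (t - c (j + 1)) (by linarith)
    exact ⟨w.extend_s1 hin t (by linarith), rfl, by simp [extend_s1]⟩

end PathWalk

section MaxProfit

variable {n : ℕ} {c : ℕ → ℝ} {W : ℕ → Finset (ℝ × ℝ)} {π : ℕ → ℝ}

theorem PathWalk.profit_le_maxProfit (hπ : ∀ k, 0 ≤ π k) (w : PathWalk n c) {i : ℕ} {t : ℝ}
    (hq : w.q = i) (hb : w.b i = t) : w.profit W π ≤ maxProfit n c W π i t := by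
  refine le_csSup ⟨∑ k ∈ Finset.Icc 1 n, π k, ?_⟩ ⟨w, hq, hb, rfl⟩
  rintro _ ⟨w, -, -, rfl⟩
  exact w.profit_le_sum_s1 W π hπ

theorem maxProfit_le {i : ℕ} (h1 : 1 ≤ i) (hin : i ≤ n) {t M : ℝ}
    (ht : ∑ l ∈ Finset.Icc 2 i, c l ≤ t)
    (hM : ∀ w : PathWalk n c, w.q = i → w.b i = t → w.profit W π ≤ M) :
    maxProfit n c W π i t ≤ M := by
  obtain ⟨w, hq, hb⟩ := PathWalk.exists_departure i h1 hin t ht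
  refine csSup_le ⟨_, w, hq, hb, rfl⟩ ?_
  rintro _ ⟨w, hq, hb, rfl⟩
  exact hM w hq hb

/-- The maximum profit is monotone in the departure time. -/
theorem maxProfit_mono (hπ : ∀ k, 0 ≤ π k) {i : ℕ} (h1 : 1 ≤ i)
    (hin : i ≤ n) {s t : ℝ} (hs : ∑ l ∈ Finset.Icc 2 i, c l ≤ s) (hst : s ≤ t) :
    maxProfit n c W π i s ≤ maxProfit n c W π i t := by
  refine maxProfit_le h1 hin hs fun w hq hb => ?_
  subst hq
  have ha := w.hab w.q w.hq1 le_rfl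
  refine (w.profit_le_profit_setDeparture W π hπ t (by linarith)
    fun rd _ _ h => by linarith).trans ?_
  exact PathWalk.profit_le_maxProfit hπ _ rfl (by simp [PathWalk.setDeparture])

/-- A walk gains at most the profit of its last vertex over the best walk to the previous one. -/
theorem PathWalk.profit_le_maxProfit_pred_add (hπ : ∀ k, 0 ≤ π k)
    (w : PathWalk n c) {j : ℕ} (h1 : 1 ≤ j) (hq : w.q = j + 1) :
    w.profit W π ≤ maxProfit n c W π j (w.b (j + 1) - c (j + 1)) +
      if ∃ rd ∈ W (j + 1), w.a (j + 1) ≤ rd.2 ∧ rd.1 ≤ w.b (j + 1) then π (j + 1) else 0 := by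
  rw [w.profit_eq_profit_truncate_add W π j h1 hq]
  gcongr
  have hstep := w.hstep j h1 (by omega)
  have hab := w.hab (j + 1) (by omega) hq.ge
  have habj := w.hab j h1 (by omega)
  have hd := w.dist_le_arrival j h1 (by omega)
  have hn := w.hqn
  refine ((w.truncate j h1 (by omega)).profit_le_maxProfit hπ rfl rfl).trans ?_
  refine maxProfit_mono hπ h1 (by omega) ?_ ?_
  · exact hd.trans habj
  · change w.b j ≤ _
    linarith

/-- Extending a best walk to `v_j` so as to arrive at `v_{j+1}` and leave it at time `t`. -/
theorem maxProfit_pred_add_le (hπ : ∀ k, 0 ≤ π k) {j : ℕ} (h1 : 1 ≤ j)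
    (hjn : j + 1 ≤ n) {t : ℝ} (ht : ∑ l ∈ Finset.Icc 2 (j + 1), c l ≤ t) :
    maxProfit n c W π j (t - c (j + 1)) +
      (if ∃ rd ∈ W (j + 1), rd.1 ≤ t ∧ t ≤ rd.2 then π (j + 1) else 0) ≤
      maxProfit n c W π (j + 1) t := by
  rw [Finset.sum_Icc_succ_top (by omega)] at ht
  rw [← le_sub_iff_add_le]
  refine maxProfit_le h1 (by omega) (by linarith) fun w hq hb => ?_
  subst hq
  rw [le_sub_iff_add_le]
  have hbt : w.b w.q + c (w.q + 1) = t := by linarith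
  have key := (w.extend_s1 hjn t hbt.le).profit_le_maxProfit (W := W) hπ (i := w.q + 1) (t := t) rfl
    (by simp [PathWalk.extend_s1])
  rw [w.profit_extend W π hjn t hbt.le, hbt] at key
  simpa only [and_comm] using key

end MaxProfit

/-- The recurrence for `Π_i(t)` on a directed path, for `2 ≤ i ≤ n` and `t ≥ D_i`:
(a) if `t` lies in some window of `v_i`, then `Π_i(t) = Π_{i-1}(t - c_i) + π(v_i)`;
(b) otherwise, if `d*` is the largest deadline of a window of `v_i` with `d* < t`
    and `d* ≥ D_i` exists, then `Π_i(t) = max (Π_{i-1}(t - c_i)) (Π_i(d*))`;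
(c) otherwise `Π_i(t) = Π_{i-1}(t - c_i)`. -/
theorem stmt1 (n : ℕ) (hn : 1 ≤ n) (c : ℕ → ℝ) (hc : ∀ i, 0 ≤ c i)
    (π : ℕ → ℝ) (hπ : ∀ i, 0 ≤ π i)
    (W : ℕ → Finset (ℝ × ℝ)) (hW : ∀ i, ∀ rd ∈ W i, 0 ≤ rd.1 ∧ rd.1 ≤ rd.2)
    (i : ℕ) (hi2 : 2 ≤ i) (hin : i ≤ n) (t : ℝ)
    (ht : ∑ k ∈ Finset.Icc 2 i, c k ≤ t) :
    -- (a)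
    ((∃ rd ∈ W i, rd.1 ≤ t ∧ t ≤ rd.2) →
      maxProfit n c W π i t = maxProfit n c W π (i - 1) (t - c i) + π i) ∧
    -- (b)
    ((¬ ∃ rd ∈ W i, rd.1 ≤ t ∧ t ≤ rd.2) →
      ∀ dstar : ℝ, (∃ rd ∈ W i, rd.2 = dstar) → dstar < t →
        (∑ k ∈ Finset.Icc 2 i, c k) ≤ dstar →
        (∀ rd ∈ W i, rd.2 < t → rd.2 ≤ dstar) →
        maxProfit n c W π i t =
          max (maxProfit n c W π (i - 1) (t - c i)) (maxProfit n c W π i dstar)) ∧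
    -- (c)
    ((¬ ∃ rd ∈ W i, rd.1 ≤ t ∧ t ≤ rd.2) →
      (¬ ∃ rd ∈ W i, rd.2 < t ∧ (∑ k ∈ Finset.Icc 2 i, c k) ≤ rd.2) →
      maxProfit n c W π i t = maxProfit n c W π (i - 1) (t - c i)) := by
  obtain ⟨j, rfl⟩ : ∃ j, i = j + 1 := ⟨i - 1, by omega⟩
  have h1 : 1 ≤ j := by omega
  rw [Nat.add_sub_cancel]
  have hge := maxProfit_pred_add_le (W := W) hπ h1 hin ht
  refine ⟨fun hin_win => ?_, fun hout dstar _ hlt hD hmax => ?_, fun hout hno => ?_⟩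
  · rw [if_pos hin_win] at hge
    refine le_antisymm (maxProfit_le (by omega) hin ht fun w hq hb => ?_) hge
    refine (w.profit_le_maxProfit_pred_add hπ h1 hq).trans ?_
    rw [hb]
    gcongr
    split_ifs
    · exact le_rfl
    · exact hπ _
  · rw [if_neg hout, add_zero] at hge
    refine le_antisymm (maxProfit_le (by omega) hin ht fun w hq hb => ?_)
      (max_le hge (maxProfit_mono hπ (by omega) hin hD hlt.le))
    by_cases hcol : ∃ rd ∈ W (j + 1), w.a (j + 1) ≤ rd.2 ∧ rd.1 ≤ w.b (j + 1)
    · refine le_max_of_le_right ?_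
      have hdead : ∀ rd ∈ W (j + 1), rd.1 ≤ t → rd.2 ≤ dstar := fun rd hrd hr =>
        hmax rd hrd (lt_of_not_ge fun h => hout ⟨rd, hrd, hr, h⟩)
      obtain ⟨rd, hrd, ha, hr⟩ := hcol
      have had : w.a w.q ≤ dstar := by
        rw [hq]
        exact ha.trans (hdead rd hrd (hb ▸ hr))
      refine (w.profit_le_profit_setDeparture W π hπ dstar had ?_).trans ?_
      · rw [hq, hb]
        exact fun rd hrd _ hr => (hW _ rd hrd).2.trans (hdead rd hrd hr)
      · exact PathWalk.profit_le_maxProfit hπ _ hq (by simp [PathWalk.setDeparture, hq])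
    · refine le_max_of_le_left ?_
      have := w.profit_le_maxProfit_pred_add (W := W) hπ h1 hq
      rwa [if_neg hcol, add_zero, hb] at this
  · rw [if_neg hout, add_zero] at hge
    refine le_antisymm (maxProfit_le (by omega) hin ht fun w hq hb => ?_) hge
    have hcol : ¬ ∃ rd ∈ W (j + 1), w.a (j + 1) ≤ rd.2 ∧ rd.1 ≤ w.b (j + 1) := by
      rintro ⟨rd, hrd, ha, hr⟩
      refine hno ⟨rd, hrd, lt_of_not_ge fun h => hout ⟨rd, hrd, hb ▸ hr, h⟩, ?_⟩
      exact (w.dist_le_arrival (j + 1) (by omega) hq.ge).trans ha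
    have := w.profit_le_maxProfit_pred_add (W := W) hπ h1 hq
    rwa [if_neg hcol, add_zero, hb] at this
end

section
/- Consider the Orienteering Problem with multiple time windows on a directed path with n vertices: timed walks start at v_1 at time 0 and all departure times must be at most a given budget B ≥ 0. Then there exists a timed walk of maximum profit in which, for every k, the departure time b_k from v_k belongs to the finite set {D_k} ∪ {r + D_k − D_h : 1 ≤ h ≤ k and r is the left endpoint of some window of v_h}. -/
open scoped Classical

/-- The distance from `v_1` to `v_k` along the path. -/
noncomputable def pathDist (c : ℕ → ℝ) (k : ℕ) : ℝ := ∑ l ∈ Finset.Icc 2 k, c l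

theorem pathDist_one (c : ℕ → ℝ) : pathDist c 1 = 0 := by simp [pathDist]

theorem pathDist_succ (c : ℕ → ℝ) {k : ℕ} (hk : 1 ≤ k) :
    pathDist c (k + 1) = pathDist c k + c (k + 1) :=
  Finset.sum_Icc_succ_top (by omega) _

/-- The candidate values of the delay `b k - pathDist c k` at `v_k`: no delay, or a delay that
makes the departure from some earlier vertex coincide with the opening of one of its windows. -/
noncomputable def candidateDelays (c : ℕ → ℝ) (W : ℕ → Finset (ℝ × ℝ)) (k : ℕ) : Finset ℝ :=
  insert 0 ((Finset.Icc 1 k).biUnion fun h => (W h).image fun rd => rd.1 - pathDist c h)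

theorem mem_candidateDelays {c : ℕ → ℝ} {W : ℕ → Finset (ℝ × ℝ)} {k : ℕ} {x : ℝ} :
    x ∈ candidateDelays c W k ↔
      x = 0 ∨ ∃ h, (1 ≤ h ∧ h ≤ k) ∧ ∃ rd ∈ W h, rd.1 - pathDist c h = x := by
  simp only [candidateDelays, Finset.mem_insert, Finset.mem_biUnion, Finset.mem_Icc,
    Finset.mem_image]

theorem candidateDelays_mono (c : ℕ → ℝ) (W : ℕ → Finset (ℝ × ℝ)) :
    Monotone (candidateDelays c W) := by
  intro k l hkl x hx
  rw [mem_candidateDelays] at hx ⊢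
  exact hx.imp_right fun ⟨h, ⟨h1, h2⟩, hr⟩ => ⟨h, ⟨h1, h2.trans hkl⟩, hr⟩

/-- A finite set with an element below `x` has a largest element below `x`. -/
theorem Finset.exists_greatest_le {α : Type*} [LinearOrder α] (s : Finset α) {x y : α}
    (hy : y ∈ s) (hyx : y ≤ x) : ∃ m ∈ s, m ≤ x ∧ ∀ z ∈ s, z ≤ x → z ≤ m := by
  obtain ⟨m, hm, hmax⟩ := (s.filter (· ≤ x)).exists_max_image id
    ⟨y, Finset.mem_filter.2 ⟨hy, hyx⟩⟩
  rw [Finset.mem_filter] at hm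
  exact ⟨m, hm.1, hm.2, fun z hz hzx => hmax z (Finset.mem_filter.2 ⟨hz, hzx⟩)⟩

namespace PathWalk

variable {n : ℕ} {c : ℕ → ℝ}

theorem pathDist_le_departure (w : PathWalk n c) {k : ℕ} (hk : 1 ≤ k) (hkq : k ≤ w.q) :
    pathDist c k ≤ w.b k := by
  induction k, hk using Nat.le_induction with
  | base =>
    rw [pathDist_one, ← w.ha1]
    exact w.hab 1 le_rfl hkq
  | succ k hk ih =>
    have := w.hab (k + 1) (by omega) hkq
    rw [w.hstep k hk hkq] at this
    rw [pathDist_succ c hk]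
    linarith [ih (by omega)]

/-- The walk to `v_q` that departs from `v_k` with delay `δ k`. -/
noncomputable def ofDelays (q : ℕ) (hq1 : 1 ≤ q) (hqn : q ≤ n) (δ : ℕ → ℝ) (h0 : 0 ≤ δ 1)
    (hδ : ∀ k, 1 ≤ k → k < q → δ k ≤ δ (k + 1)) : PathWalk n c where
  q := q
  hq1 := hq1
  hqn := hqn
  a k := if k ≤ 1 then 0 else δ (k - 1) + pathDist c k
  b k := δ k + pathDist c k
  ha1 := if_pos le_rfl
  hab k hk hkq := by
    obtain rfl | ⟨k, hk', rfl⟩ : k = 1 ∨ ∃ j, 1 ≤ j ∧ k = j + 1 := by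
      rcases hk.eq_or_lt with h | h
      · exact .inl h.symm
      · exact .inr ⟨k - 1, by omega, by omega⟩
    · simpa [pathDist_one] using h0
    · rw [if_neg (by omega), Nat.add_sub_cancel]
      linarith [hδ k hk' hkq]
  hstep k hk hkq := by
    rw [if_neg (by omega), Nat.add_sub_cancel, pathDist_succ c hk, add_assoc]

theorem profit_le_profit {w w' : PathWalk n c} {W : ℕ → Finset (ℝ × ℝ)} {π : ℕ → ℝ}
    (hπ : ∀ i, 0 ≤ π i) (h : ∀ i, 1 ≤ i → w.collects W i → w'.collects W i) :
    w.profit W π ≤ w'.profit W π := by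
  refine Finset.sum_le_sum fun i hi => ?_
  have := h i (Finset.mem_Icc.1 hi).1
  split_ifs with h1 h2
  · exact le_rfl
  · exact absurd (this h1) h2
  · exact hπ i
  · exact le_rfl

theorem finite_range_profit (W : ℕ → Finset (ℝ × ℝ)) (π : ℕ → ℝ) :
    (Set.range fun w : PathWalk n c => w.profit W π).Finite := by
  refine ((Finset.Icc 1 n).powerset.image fun s => ∑ i ∈ s, π i).finite_toSet.subset ?_
  rintro _ ⟨w, rfl⟩
  rw [Finset.mem_coe, Finset.mem_image]
  exact ⟨(Finset.Icc 1 n).filter (w.collects W), Finset.mem_powerset.2 (Finset.filter_subset _ _),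
    Finset.sum_filter _ _⟩

/-- Lowering every delay to the largest candidate below it loses no collected vertex. -/
theorem exists_candidateDelays (w : PathWalk n c) (W : ℕ → Finset (ℝ × ℝ)) :
    ∃ w' : PathWalk n c, w'.q = w.q ∧
      (∀ k, 1 ≤ k → k ≤ w.q → w'.b k ≤ w.b k ∧ w'.b k - pathDist c k ∈ candidateDelays c W k) ∧
      ∀ i, 1 ≤ i → w.collects W i → w'.collects W i := by
  have hex : ∀ k, ∃ m, 1 ≤ k → k ≤ w.q → m ∈ candidateDelays c W k ∧
      m ≤ w.b k - pathDist c k ∧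
      ∀ z ∈ candidateDelays c W k, z ≤ w.b k - pathDist c k → z ≤ m := by
    intro k
    by_cases hk : 1 ≤ k ∧ k ≤ w.q
    · obtain ⟨m, hm⟩ := (candidateDelays c W k).exists_greatest_le
        (mem_candidateDelays.2 (.inl rfl)) (sub_nonneg.2 (w.pathDist_le_departure hk.1 hk.2))
      exact ⟨m, fun _ _ => hm⟩
    · exact ⟨0, fun h1 h2 => absurd ⟨h1, h2⟩ hk⟩
  choose δ hδ using hex
  have hmono : ∀ k, 1 ≤ k → k < w.q → δ k ≤ δ (k + 1) := by
    intro k hk hkq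
    obtain ⟨hmem, hle, -⟩ := hδ k hk hkq.le
    refine (hδ (k + 1) (by omega) hkq).2.2 _ (candidateDelays_mono c W k.le_succ hmem) ?_
    have := w.hab (k + 1) (by omega) hkq
    rw [w.hstep k hk hkq] at this
    rw [pathDist_succ c hk]
    linarith
  have h0 : 0 ≤ δ 1 := (hδ 1 le_rfl w.hq1).2.2 0 (mem_candidateDelays.2 (.inl rfl))
    (sub_nonneg.2 (w.pathDist_le_departure le_rfl w.hq1))
  refine ⟨ofDelays w.q w.hq1 w.hqn δ h0 hmono, rfl, fun k hk hkq => ⟨?_, ?_⟩, ?_⟩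
  · change δ k + pathDist c k ≤ w.b k
    linarith [(hδ k hk hkq).2.1]
  · change δ k + pathDist c k - pathDist c k ∈ _
    rw [add_sub_cancel_right]
    exact (hδ k hk hkq).1
  · rintro i hi ⟨hiq, rd, hrd, had, hrb⟩
    refine ⟨hiq, rd, hrd, le_trans ?_ had, ?_⟩
    · change (if i ≤ 1 then 0 else δ (i - 1) + pathDist c i) ≤ w.a i
      split_ifs with h1
      · obtain rfl : i = 1 := le_antisymm h1 hi
        exact w.ha1.ge
      · obtain ⟨j, rfl⟩ : ∃ j, i = j + 1 := ⟨i - 1, by omega⟩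
        rw [Nat.add_sub_cancel, w.hstep j (by omega) hiq, pathDist_succ c (by omega)]
        linarith [(hδ j (by omega) (by omega)).2.1]
    · change rd.1 ≤ δ i + pathDist c i
      have := (hδ i hi hiq).2.2 (rd.1 - pathDist c i)
        (mem_candidateDelays.2 (.inr ⟨i, ⟨hi, le_rfl⟩, rd, hrd, rfl⟩)) (by linarith)
      linarith

end PathWalk

/-- On a directed path with budget `B` (all departure times at most `B`), there exists
a timed walk of maximum profit in which every departure time `b k` belongs to
`{D_k} ∪ {r + D_k - D_h : 1 ≤ h ≤ k, r a left endpoint of a window of v_h}`,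
where `D_k = c_2 + ⋯ + c_k`. -/
theorem stmt2 (n : ℕ) (hn : 1 ≤ n) (c : ℕ → ℝ) (hc : ∀ i, 0 ≤ c i)
    (π : ℕ → ℝ) (hπ : ∀ i, 0 ≤ π i)
    (W : ℕ → Finset (ℝ × ℝ)) (hW : ∀ i, ∀ rd ∈ W i, 0 ≤ rd.1 ∧ rd.1 ≤ rd.2)
    (B : ℝ) (hB : 0 ≤ B) :
    ∃ w : PathWalk n c,
      (∀ k, 1 ≤ k → k ≤ w.q → w.b k ≤ B) ∧
      (∀ w' : PathWalk n c, (∀ k, 1 ≤ k → k ≤ w'.q → w'.b k ≤ B) →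
        w'.profit W π ≤ w.profit W π) ∧
      (∀ k, 1 ≤ k → k ≤ w.q →
        w.b k = ∑ l ∈ Finset.Icc 2 k, c l ∨
        ∃ h, 1 ≤ h ∧ h ≤ k ∧ ∃ rd ∈ W h,
          w.b k = rd.1 + (∑ l ∈ Finset.Icc 2 k, c l) - ∑ l ∈ Finset.Icc 2 h, c l) := by
  set F : Set (PathWalk n c) := {w | ∀ k, 1 ≤ k → k ≤ w.q → w.b k ≤ B}
  have hne : F.Nonempty := by
    refine ⟨PathWalk.ofDelays 1 le_rfl hn 0 le_rfl fun _ _ _ => le_rfl, fun k hk hk1 => ?_⟩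
    obtain rfl : k = 1 := le_antisymm hk1 hk
    change 0 + pathDist c 1 ≤ B
    rwa [pathDist_one, add_zero]
  obtain ⟨w₀, hw₀, hmax⟩ := Set.Finite.exists_maximalFor' (fun w : PathWalk n c => w.profit W π) F
    ((PathWalk.finite_range_profit W π).subset (Set.image_subset_range _ _)) hne
  obtain ⟨w, hq, hb, hcol⟩ := w₀.exists_candidateDelays W
  refine ⟨w, fun k hk hkq => ?_, fun w' hw' => ?_, fun k hk hkq => ?_⟩
  · rw [hq] at hkq
    exact (hb k hk hkq).1.trans (hw₀ k hk hkq)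
  · exact ((le_total _ _).elim (hmax hw') id).trans (PathWalk.profit_le_profit hπ hcol)
  · rw [hq] at hkq
    change w.b k = pathDist c k ∨ ∃ h, 1 ≤ h ∧ h ≤ k ∧ ∃ rd ∈ W h,
      w.b k = rd.1 + pathDist c k - pathDist c h
    rcases mem_candidateDelays.1 (hb k hk hkq).2 with h0 | ⟨h, ⟨h1, h2⟩, rd, hrd, hr⟩
    · exact .inl (sub_eq_zero.1 h0)
    · exact .inr ⟨h, h1, h2, rd, hrd, by linarith⟩
end

section
/- Let φ be a propositional formula in 3-CNF with variables x_1, …, x_n and clauses γ_1, …, γ_m, where each clause contains exactly three literals over three pairwise distinct variables. Let C = n + m and consider the directed cycle with C vertices and unit edge costs. Assign to vertex v_i (1 ≤ i ≤ n) the set of collection times P_i = {2iC, 2iC + C − 1}, and to vertex v_{n+j} (1 ≤ j ≤ m) the set Q_j = {2iC + (n + j − i) : the literal x_i occurs in γ_j} ∪ {2iC + C − (m − j + i) − 1 : the literal ¬x_i occurs in γ_j}. Then φ is satisfiable if and only if there exists a timed walk p with p(0) = 0 such that for every 1 ≤ i ≤ n there is t ∈ P_i with p(t) = i − 1, and for every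 1 ≤ j ≤ m there is t ∈ Q_j with p(t) = n + j − 1. -/
theorem exists_displacement_of_step {C : ℕ} {p : ℕ → ZMod C}
    (hp : ∀ t : ℕ, p (t + 1) = p t ∨ p (t + 1) = p t + 1) (t d : ℕ) :
    ∃ k ≤ d, p (t + d) = p t + (k : ZMod C) := by
  induction d with
  | zero => exact ⟨0, le_rfl, by simp⟩
  | succ d ih =>
    obtain ⟨k, hk, h⟩ := ih
    rcases hp (t + d) with h' | h'
    · exact ⟨k, by omega, by rw [← add_assoc, h', h]⟩
    · exact ⟨k + 1, by omega, by rw [← add_assoc, h', h]; push_cast; ring⟩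

theorem natCast_zmod_ne_zero_of_lt {C k : ℕ} (hk : 0 < k) (hC : k < C) :
    (k : ZMod C) ≠ 0 := by
  rw [Ne, ZMod.natCast_eq_zero_iff]
  exact Nat.not_dvd_of_pos_of_lt hk hC

/-- The lifted position, shifted by one, at offset `s ≤ 2 * C` of round `i`: the walk moves for
`C - 1` steps, and then just as far as it takes to reach the start of the next round, where
`e i` is `0` if the walk starts round `i` at `v_i` and `1` if it starts one vertex later. -/
def roundPos (C : ℕ) (e : ℕ → ℕ) (i s : ℕ) : ℕ :=
  i * (C + 1) + e i + min s (C - 1) + min (s - (C - 1)) (2 + e (i + 1) - e i)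

/-- The lifted position, shifted by one, at time `t`. -/
def liftedPos (C : ℕ) (e : ℕ → ℕ) (t : ℕ) : ℕ :=
  roundPos C e (t / (2 * C)) (t % (2 * C))

theorem liftedPos_round {C : ℕ} (e : ℕ → ℕ) (i : ℕ) {s : ℕ} (hs : s < 2 * C) :
    liftedPos C e (2 * i * C + s) = roundPos C e i s := by
  have h : 2 * i * C + s = s + 2 * C * i := by ring
  rw [liftedPos, h, Nat.add_mul_div_left _ _ (by omega), Nat.add_mul_mod_self_left,
    Nat.div_eq_of_lt hs, Nat.mod_eq_of_lt hs, zero_add]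

theorem roundPos_two_mul {C : ℕ} (hC : 2 ≤ C) {e : ℕ → ℕ} (he : ∀ i, e i ≤ 1) (i : ℕ) :
    roundPos C e i (2 * C) = roundPos C e (i + 1) 0 := by
  have h₁ := he i
  have h₂ := he (i + 1)
  simp only [roundPos, add_mul i 1]
  omega

theorem liftedPos_succ {C : ℕ} (hC : 2 ≤ C) {e : ℕ → ℕ} (he : ∀ i, e i ≤ 1) (t : ℕ) :
    liftedPos C e (t + 1) = liftedPos C e t ∨ liftedPos C e (t + 1) = liftedPos C e t + 1 := by
  obtain ⟨i, s, hs, rfl⟩ : ∃ i s, s < 2 * C ∧ t = 2 * i * C + s :=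
    ⟨t / (2 * C), t % (2 * C), Nat.mod_lt _ (by omega), by
      have := Nat.div_add_mod t (2 * C)
      linarith⟩
  have key : liftedPos C e (2 * i * C + s + 1) = roundPos C e i (s + 1) := by
    rcases Nat.lt_or_ge (s + 1) (2 * C) with h | h
    · exact liftedPos_round e i h
    · have h' : s + 1 = 2 * C := by omega
      have h₂ : 2 * i * C + s + 1 = 2 * (i + 1) * C + 0 := by rw [add_assoc, h']; ring
      rw [h₂, liftedPos_round e (i + 1) (by omega), h', roundPos_two_mul hC he]
  rw [key, liftedPos_round e i hs]
  simp only [roundPos]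
  omega

theorem cast_liftedPos_round {C : ℕ} (e : ℕ → ℕ) (i : ℕ) {s : ℕ} (hs : s < C) :
    (liftedPos C e (2 * i * C + s) : ZMod C) = i + e i + s := by
  rw [liftedPos_round e i (by omega)]
  have h : roundPos C e i s = i * (C + 1) + e i + s := by simp only [roundPos]; omega
  rw [h]
  push_cast
  rw [ZMod.natCast_self]
  ring

/-- Reduction from 3SAT to the covering orienteering problem with multiple time
windows on a directed cycle with `C = n + m` vertices and unit edge costs.

The 3-CNF formula `φ` over variables `x_1, …, x_n` has clauses `γ_1, …, γ_m`; the
`s`-th literal of clause `γ_j` (for `j : Fin m`, representing clause `γ_{j+1}`, and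
`s : Fin 3`) is the variable `x_{var j s}` if `sign j s = true` and its negation
otherwise; the three variables of each clause are pairwise distinct.

A timed walk is a position function `p : ℕ → ZMod C` that at each time step either
stays or moves to the cyclic successor; it is at vertex `v_q` at time `t` iff
`p t = q - 1`. Vertex `v_i` (for `1 ≤ i ≤ n`) must be collected at a time in
`P_i = {2iC, 2iC + C - 1}`, and vertex `v_{n+j}` (for `1 ≤ j ≤ m`) at a time in
`Q_j`, which contains `2iC + (n + j - i)` for every positive occurrence of `x_i`
in `γ_j` and `2iC + C - (m - j + i) - 1` for every negated occurrence.

Then `φ` is satisfiable iff such a timed walk starting at position `0` exists. -/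
theorem stmt13 (n m : ℕ) (hn : 1 ≤ n) (hm : 1 ≤ m) (C : ℕ) (hC : C = n + m)
    (var : Fin m → Fin 3 → ℕ) (sign : Fin m → Fin 3 → Bool)
    (hvar : ∀ j s, 1 ≤ var j s ∧ var j s ≤ n)
    (hdist : ∀ (j : Fin m) (s s' : Fin 3), s ≠ s' → var j s ≠ var j s') :
    (∃ σ : ℕ → Bool, ∀ j : Fin m, ∃ s : Fin 3, σ (var j s) = sign j s) ↔
      ∃ p : ℕ → ZMod C,
        (∀ t : ℕ, p (t + 1) = p t ∨ p (t + 1) = p t + 1) ∧ p 0 = 0 ∧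
        (∀ i, 1 ≤ i → i ≤ n →
          p (2 * i * C) = ((i - 1 : ℕ) : ZMod C) ∨
          p (2 * i * C + C - 1) = ((i - 1 : ℕ) : ZMod C)) ∧
        (∀ j : Fin m, ∃ s : Fin 3,
          if sign j s then
            p (2 * var j s * C + (n + (j.1 + 1) - var j s)) =
              ((n + (j.1 + 1) - 1 : ℕ) : ZMod C)
          else
            p (2 * var j s * C + C - (m - (j.1 + 1) + var j s) - 1) =
              ((n + (j.1 + 1) - 1 : ℕ) : ZMod C)) := by
  subst hC
  constructor
  · rintro ⟨σ, hσ⟩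
    set e : ℕ → ℕ := fun i => if i ≠ 0 ∧ σ i = true then 0 else 1 with he_def
    have he : ∀ i, e i ≤ 1 := fun i => by simp only [he_def]; split_ifs <;> omega
    have he_true : ∀ i, 1 ≤ i → σ i = true → e i = 0 := fun i hi h => by
      simp [he_def, h, show i ≠ 0 by omega]
    have he_false : ∀ i, σ i = false → e i = 1 := fun i h => by simp [he_def, h]
    refine ⟨fun t => (liftedPos (n + m) e t : ZMod (n + m)) - 1, fun t => ?_, ?_, fun i hi hin => ?_,
      fun j => ?_⟩
    · rcases liftedPos_succ (by omega : 2 ≤ n + m) he t with h | h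
      · left; simp only [h]
      · right; simp only [h]; push_cast; ring
    · have h := cast_liftedPos_round (C := n + m) e 0 (s := 0) (by omega)
      simp only [mul_zero, zero_mul, add_zero] at h
      have he_zero : e 0 = 1 := by simp [he_def]
      simp [h, he_zero]
    · cases h : σ i
      · right
        have h' := cast_liftedPos_round (C := n + m) e i (s := n + m - 1) (by omega)
        rw [← Nat.add_sub_assoc (by omega)] at h'
        simp only [h', he_false i h]
        rw [Nat.cast_sub hi, Nat.cast_sub (by omega : 1 ≤ n + m), ZMod.natCast_self]
        push_cast
        ring
      · left
        have h' := cast_liftedPos_round (C := n + m) e i (s := 0) (by omega)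
        rw [add_zero] at h'
        simp only [h', he_true i hi h]
        rw [Nat.cast_sub hi]
        push_cast
        ring
    · obtain ⟨s, hs⟩ := hσ j
      refine ⟨s, ?_⟩
      obtain ⟨hv, hvn⟩ := hvar j s
      have hj := j.2
      generalize var j s = i at *
      cases h : sign j s
      · rw [h] at hs
        have ht : 2 * i * (n + m) + (n + m) - (m - (j.1 + 1) + i) - 1 =
            2 * i * (n + m) + (n + j.1 - i) := by omega
        simp only [Bool.false_eq_true, if_false]
        rw [ht, cast_liftedPos_round e i (by omega), he_false i hs,
          Nat.cast_sub (by omega : i ≤ n + j.1), ← add_assoc n, Nat.add_sub_cancel]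
        push_cast
        ring
      · rw [h] at hs
        simp only [if_true]
        rw [cast_liftedPos_round e i (by omega), he_true i hv hs,
          Nat.cast_sub (by omega : i ≤ n + (j.1 + 1)), ← add_assoc n, Nat.add_sub_cancel]
        push_cast
        ring
  · rintro ⟨p, hp, -, hP, hQ⟩
    classical
    refine ⟨fun i => decide (p (2 * i * (n + m)) = ((i - 1 : ℕ) : ZMod (n + m))), fun j => ?_⟩
    obtain ⟨s, hs⟩ := hQ j
    refine ⟨s, ?_⟩
    obtain ⟨hv, hvn⟩ := hvar j s
    have hPi := hP _ hv hvn
    have hj := j.2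
    generalize var j s = i at *
    cases h : sign j s
    · simp only [h, Bool.false_eq_true, if_false] at hs
      simp only [decide_eq_false_iff_not]
      intro hi
      have ht : 2 * i * (n + m) + (n + m) - (m - (j.1 + 1) + i) - 1 =
          2 * i * (n + m) + (n + j.1 - i) := by omega
      obtain ⟨k, hk, hd⟩ := exists_displacement_of_step hp (2 * i * (n + m)) (n + j.1 - i)
      rw [ht, hd, hi] at hs
      refine natCast_zmod_ne_zero_of_lt (C := n + m) (k := n + j.1 + 1 - i - k)
        (by omega) (by omega) ?_
      have hsum : n + (j.1 + 1) - 1 = (i - 1) + k + (n + j.1 + 1 - i - k) := by omega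
      rw [hsum] at hs
      push_cast at hs
      simpa using hs.symm
    · simp only [h, if_true] at hs
      simp only [decide_eq_true_eq]
      refine hPi.resolve_right fun hi => ?_
      obtain ⟨k, hk, hd⟩ := exists_displacement_of_step hp
        (2 * i * (n + m) + (n + (j.1 + 1) - i)) (n + m - 1 - (n + (j.1 + 1) - i))
      have ht : 2 * i * (n + m) + (n + (j.1 + 1) - i) + (n + m - 1 - (n + (j.1 + 1) - i)) =
          2 * i * (n + m) + (n + m) - 1 := by omega
      rw [ht, hi, hs] at hd
      refine natCast_zmod_ne_zero_of_lt (C := n + m) (k := n + j.1 + 1 - i + k)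
        (by omega) (by omega) ?_
      have hsum : n + (j.1 + 1) - 1 + k = (i - 1) + (n + j.1 + 1 - i + k) := by omega
      rw [← Nat.cast_add, hsum, Nat.cast_add] at hd
      simpa using hd.symm
end

section
/- Let a dynamic undirected path with vertices v_1, …, v_n and edges e_p = {v_p, v_{p+1}} (1 ≤ p < n), each with a positive integer cost c_p and an active set A_p ⊆ ℕ, be given, and let W be a timed walk starting at v_σ at time 0 with final time t_f. Let i be the smallest and j the largest index of a vertex visited by W (so i ≤ σ ≤ j), and suppose the first time at which W visits v_i is at most the first time at which it visits v_j. Then the greedy left-then-right sweep — the timed walk that starts at v_σ at time 0, repeatedly crosses the next edge toward v_i departing at the earliest active time not before its current time until it reaches v_i, and then repeatedly crosses the next edge toward v_j departing at the earliest active time not before its current time until it reaches v_j — is well defined (all required earliest active departure times exist), visits every vertex v_i, v_{i+1}, …, v_j, and has final time at most t_f. -/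
/-- A timed walk on the dynamic undirected path `v_1 − v_2 − ⋯ − v_n`, where edge
`e_p = {v_p, v_{p+1}}` (for `1 ≤ p < n`) has positive integer cost `c p` and active
set `A p ⊆ ℕ`. At step `k` the walk is at vertex `v_{u k}` at time `t k`; each move
crosses an adjacent edge `e`, departing at some time `τ ∈ A e` with `τ ≥ t k` and
arriving at time `τ + c e` (the edge between `v_a` and `v_{a+1}` is indexed by the
smaller endpoint `a`). -/
structure DynPathWalk (n : ℕ) (c : ℕ → ℕ) (A : ℕ → Set ℕ) where
  len : ℕ
  u : ℕ → ℕ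
  t : ℕ → ℕ
  hu : ∀ k ≤ len, 1 ≤ u k ∧ u k ≤ n
  hstep : ∀ k < len, (u (k + 1) = u k + 1 ∨ u k = u (k + 1) + 1) ∧
    ∃ τ, t k ≤ τ ∧ τ ∈ A (min (u k) (u (k + 1))) ∧
      t (k + 1) = τ + c (min (u k) (u (k + 1)))

namespace DynPathWalk

variable {n : ℕ} {c : ℕ → ℕ} {A : ℕ → Set ℕ}

theorem t_lt_succ (hc : ∀ p, 1 ≤ c p) (W : DynPathWalk n c A) {k : ℕ} (hk : k < W.len) :
    W.t k < W.t (k + 1) := by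
  obtain ⟨-, τ, h1, -, h3⟩ := W.hstep k hk
  have := hc (min (W.u k) (W.u (k + 1)))
  omega

theorem t_mono (hc : ∀ p, 1 ≤ c p) (W : DynPathWalk n c A) {a b : ℕ} (hab : a ≤ b)
    (hb : b ≤ W.len) : W.t a ≤ W.t b := by
  induction b, hab using Nat.le_induction with
  | base => exact le_rfl
  | succ b _ ih => exact (ih (by omega)).trans (W.t_lt_succ hc (by omega)).le

theorem le_of_t_le (hc : ∀ p, 1 ≤ c p) (W : DynPathWalk n c A) {a b : ℕ} (ha : a ≤ W.len)
    (hab : W.t a ≤ W.t b) : a ≤ b := by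
  by_contra! h
  have h1 := W.t_mono hc (a := b + 1) (b := a) h ha
  have h2 := W.t_lt_succ hc (k := b) (by omega)
  omega

/-- A walk that gets from above `p` to `p` or below crosses the edge from `p + 1` to `p`. -/
theorem exists_cross_down (W : DynPathWalk n c A) {s m p : ℕ} (hsm : s ≤ m) (hm : m ≤ W.len)
    (hs : p + 1 ≤ W.u s) (hp : W.u m ≤ p) :
    ∃ r, s ≤ r ∧ r < m ∧ W.u r = p + 1 ∧ W.u (r + 1) = p := by
  induction m, hsm using Nat.le_induction with
  | base => omega
  | succ m hsm ih =>
    rcases le_or_gt (W.u m) p with h | h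
    · obtain ⟨r, h1, h2, h3⟩ := ih (by omega) h
      exact ⟨r, h1, by omega, h3⟩
    · have := (W.hstep m hm).1
      exact ⟨m, hsm, by omega, by omega, by omega⟩

/-- A walk that gets from `p` or below to above `p` crosses the edge from `p` to `p + 1`. -/
theorem exists_cross_up (W : DynPathWalk n c A) {s m p : ℕ} (hsm : s ≤ m) (hm : m ≤ W.len)
    (hs : W.u s ≤ p) (hp : p + 1 ≤ W.u m) :
    ∃ r, s ≤ r ∧ r < m ∧ W.u r = p ∧ W.u (r + 1) = p + 1 := by
  induction m, hsm using Nat.le_induction with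
  | base => omega
  | succ m hsm ih =>
    rcases le_or_gt (p + 1) (W.u m) with h | h
    · obtain ⟨r, h1, h2, h3⟩ := ih (by omega) h
      exact ⟨r, h1, by omega, h3⟩
    · have := (W.hstep m hm).1
      exact ⟨m, hsm, by omega, by omega, by omega⟩

end DynPathWalk

/-- Position after `k` moves of the sweep that goes from `σ` down to `i` and then up. -/
def sweepPos (σ i k : ℕ) : ℕ := if k ≤ σ - i then σ - k else i + (k - (σ - i))

/-- Active times of the edge between `a` and `b` that are at least `s`. -/
def departures (A : ℕ → Set ℕ) (a b s : ℕ) : Set ℕ := {τ | s ≤ τ ∧ τ ∈ A (min a b)}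

/-- Arrival times of the greedy traversal of the vertex sequence `P`. -/
noncomputable def greedyTime (c : ℕ → ℕ) (A : ℕ → Set ℕ) (P : ℕ → ℕ) : ℕ → ℕ
  | 0 => 0
  | k + 1 => sInf (departures A (P k) (P (k + 1)) (greedyTime c A P k)) +
      c (min (P k) (P (k + 1)))

/-- If a walk crosses the edge that the greedy traversal crosses next, and reaches it no
earlier, then the greedy crossing is possible and arrives no later. -/
theorem greedyTime_succ_le {n : ℕ} {c : ℕ → ℕ} {A : ℕ → Set ℕ} (W : DynPathWalk n c A)
    {P : ℕ → ℕ} {k r : ℕ} (hr : r < W.len) (h0 : W.u r = P k) (h1 : W.u (r + 1) = P (k + 1))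
    (hle : greedyTime c A P k ≤ W.t r) :
    (departures A (P k) (P (k + 1)) (greedyTime c A P k)).Nonempty ∧
      greedyTime c A P (k + 1) ≤ W.t (r + 1) := by
  obtain ⟨-, τ, h2, h3, h4⟩ := W.hstep r hr
  rw [h0, h1] at h3 h4
  have hmem : τ ∈ departures A (P k) (P (k + 1)) (greedyTime c A P k) := ⟨hle.trans h2, h3⟩
  refine ⟨⟨τ, hmem⟩, ?_⟩
  rw [h4, greedyTime]
  exact Nat.add_le_add_right (Nat.sInf_le hmem) _

/-- Greedy left-then-right sweep on a dynamic undirected path. Let `W` be a timed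
walk starting at `v_σ` at time `0`, let `i` (resp. `j`) be the smallest (resp.
largest) index of a vertex visited by `W`, and suppose the first time at which `W`
visits `v_i` is at most the first time at which it visits `v_j`. Then the greedy
sweep — going from `v_σ` edge by edge down to `v_i`, then up to `v_j`, always
departing at the earliest active time not before the current time — is well defined
(such earliest departures exist, witnessed below), visits every vertex
`v_i, …, v_j`, and finishes no later than `W`. -/
theorem stmt14 (n : ℕ) (c : ℕ → ℕ) (hc : ∀ p, 1 ≤ c p) (A : ℕ → Set ℕ)
    (σ i j : ℕ) (W : DynPathWalk n c A) (hσ : W.u 0 = σ) (ht0 : W.t 0 = 0)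
    (hbnd : ∀ k ≤ W.len, i ≤ W.u k ∧ W.u k ≤ j)
    (hvi : ∃ k ≤ W.len, W.u k = i) (hvj : ∃ k ≤ W.len, W.u k = j)
    (hfirst : sInf {τ | ∃ k ≤ W.len, W.u k = i ∧ W.t k = τ} ≤
      sInf {τ | ∃ k ≤ W.len, W.u k = j ∧ W.t k = τ}) :
    ∃ W' : DynPathWalk n c A,
      W'.len = (σ - i) + (j - i) ∧ W'.u 0 = σ ∧ W'.t 0 = 0 ∧
      (∀ k, k < σ - i → W'.u (k + 1) + 1 = W'.u k) ∧
      (∀ k, σ - i ≤ k → k < W'.len → W'.u (k + 1) = W'.u k + 1) ∧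
      (∀ k < W'.len, ∃ τ, W'.t k ≤ τ ∧ τ ∈ A (min (W'.u k) (W'.u (k + 1))) ∧
        (∀ τ' ∈ A (min (W'.u k) (W'.u (k + 1))), W'.t k ≤ τ' → τ ≤ τ') ∧
        W'.t (k + 1) = τ + c (min (W'.u k) (W'.u (k + 1)))) ∧
      (∀ v, i ≤ v → v ≤ j → ∃ k ≤ W'.len, W'.u k = v) ∧
      W'.t W'.len ≤ W.t W.len := by
  obtain ⟨ki, hki, hui, hti⟩ := Nat.sInf_mem
    (s := {τ | ∃ k ≤ W.len, W.u k = i ∧ W.t k = τ})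
    (let ⟨k, h1, h2⟩ := hvi; ⟨W.t k, k, h1, h2, rfl⟩)
  obtain ⟨kj, hkj, huj⟩ := hvj
  have hij : ki ≤ kj := W.le_of_t_le hc hki <| by
    rw [hti]
    exact hfirst.trans (Nat.sInf_le ⟨kj, hkj, huj, rfl⟩)
  have hiσ := hbnd 0 (Nat.zero_le _)
  rw [hσ] at hiσ
  have hi1 : 1 ≤ i := hui ▸ (W.hu ki hki).1
  have hjn : j ≤ n := huj ▸ (W.hu kj hkj).2
  set P := sweepPos σ i with hP
  set T := greedyTime c A P with hT
  have hPdown : ∀ k ≤ σ - i, P k = σ - k := fun k hk => by simp [hP, sweepPos, hk]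
  have hPup : ∀ k, σ - i ≤ k → P k = i + (k - (σ - i)) := fun k hk => by
    simp only [hP, sweepPos]
    split_ifs <;> omega
  have stepDown : ∀ k < σ - i, (∀ m ≤ W.len, W.u m ≤ P k → T k ≤ W.t m) →
      ∀ m ≤ W.len, W.u m ≤ P (k + 1) →
        (departures A (P k) (P (k + 1)) (T k)).Nonempty ∧ T (k + 1) ≤ W.t m := by
    intro k hk ih m hm hum
    have e0 := hPdown k hk.le
    have e1 := hPdown (k + 1) hk
    obtain ⟨r, -, hrm, hr, hr'⟩ := W.exists_cross_down (Nat.zero_le m) hm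
      (p := P (k + 1)) (by omega) hum
    obtain ⟨hne, hle⟩ := greedyTime_succ_le W (P := P) (by omega) (by omega) hr'
      (ih r (by omega) (by omega))
    exact ⟨hne, hle.trans (W.t_mono hc hrm hm)⟩
  have down : ∀ k ≤ σ - i, ∀ m ≤ W.len, W.u m ≤ P k → T k ≤ W.t m := by
    intro k
    induction k with
    | zero => intro _ m _ _; exact Nat.zero_le _
    | succ k ih => exact fun hk m hm hum => (stepDown k hk (ih (by omega)) m hm hum).2
  have stepUp : ∀ k, σ - i ≤ k → (∀ m ≤ W.len, ki ≤ m → P k ≤ W.u m → T k ≤ W.t m) →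
      ∀ m ≤ W.len, ki ≤ m → P (k + 1) ≤ W.u m →
        (departures A (P k) (P (k + 1)) (T k)).Nonempty ∧ T (k + 1) ≤ W.t m := by
    intro k hk ih m hm hkm hum
    have e0 := hPup k hk
    have e1 := hPup (k + 1) (by omega)
    obtain ⟨r, hkr, hrm, hr, hr'⟩ := W.exists_cross_up hkm hm (p := P k) (by omega) (by omega)
    obtain ⟨hne, hle⟩ := greedyTime_succ_le W (P := P) (by omega) hr (by omega)
      (ih r (by omega) hkr hr.ge)
    exact ⟨hne, hle.trans (W.t_mono hc hrm hm)⟩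
  have up : ∀ k, σ - i ≤ k → ∀ m ≤ W.len, ki ≤ m → P k ≤ W.u m → T k ≤ W.t m := by
    intro k hk
    induction k, hk using Nat.le_induction with
    | base =>
      intro m hm hkm _
      have e := hPdown (σ - i) le_rfl
      exact (down _ le_rfl ki hki (by omega)).trans (W.t_mono hc hkm hm)
    | succ k hk ih => exact fun m hm hkm hum => (stepUp k hk ih m hm hkm hum).2
  have hne : ∀ k < (σ - i) + (j - i),
      (departures A (P k) (P (k + 1)) (T k)).Nonempty := by
    intro k hk
    rcases lt_or_ge k (σ - i) with h | h
    · have e := hPdown (k + 1) h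
      exact (stepDown k h (down k h.le) ki hki (by omega)).1
    · have e := hPup (k + 1) (by omega)
      exact (stepUp k h (up k h) kj hkj hij (by omega)).1
  have hdown : ∀ k < σ - i, P (k + 1) + 1 = P k := fun k hk => by
    have e0 := hPdown k hk.le
    have e1 := hPdown (k + 1) hk
    omega
  have hup : ∀ k, σ - i ≤ k → P (k + 1) = P k + 1 := fun k hk => by
    have e0 := hPup k hk
    have e1 := hPup (k + 1) (by omega)
    omega
  have hgreedy : ∀ k < (σ - i) + (j - i), ∃ τ, T k ≤ τ ∧ τ ∈ A (min (P k) (P (k + 1))) ∧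
      (∀ τ' ∈ A (min (P k) (P (k + 1))), T k ≤ τ' → τ ≤ τ') ∧
      T (k + 1) = τ + c (min (P k) (P (k + 1))) := fun k hk =>
    have hmem := Nat.sInf_mem (hne k hk)
    ⟨_, hmem.1, hmem.2, fun _ h1 h2 => Nat.sInf_le ⟨h2, h1⟩, rfl⟩
  refine ⟨⟨(σ - i) + (j - i), P, T, fun k hk => ?_, fun k hk => ⟨?_, ?_⟩⟩, rfl,
    hPdown 0 (Nat.zero_le _), rfl, hdown, fun k hk _ => hup k hk, hgreedy, fun v hiv hvj => ?_, ?_⟩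
  · rcases le_or_gt k (σ - i) with h | h
    · have e := hPdown k h
      omega
    · have e := hPup k h.le
      omega
  · rcases lt_or_ge k (σ - i) with h | h
    · exact Or.inr (hdown k h).symm
    · exact Or.inl (hup k h)
  · obtain ⟨τ, h1, h2, -, h4⟩ := hgreedy k hk
    exact ⟨τ, h1, h2, h4⟩
  · refine ⟨(σ - i) + (v - i), by dsimp only; omega, ?_⟩
    have e := hPup ((σ - i) + (v - i)) (by omega)
    dsimp only
    omega
  · have e := hPup ((σ - i) + (j - i)) (by omega)
    exact (up ((σ - i) + (j - i)) (by omega) kj hkj hij (by omega)).trans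
      (W.t_mono hc hkj le_rfl)
end

section
/- Let T be a finite tree with root s and nonnegative real edge costs. For every set S of vertices with s ∈ S, the minimum cost of a walk from s that visits every vertex of S equals 2·w(S) − max_{v ∈ S} d(s, v). -/
/-- The cost of a walk in a graph with edge costs `c`: the sum of the costs of the
traversed edges, counted with multiplicity. -/
noncomputable def walkCost {V : Type*} {G : SimpleGraph V} (c : Sym2 V → ℝ)
    {u v : V} (p : G.Walk u v) : ℝ :=
  (p.edges.map c).sum

/-- The tree metric induced by the edge costs `c`: the minimum cost of a walk
between two vertices. -/
noncomputable def treeDist {V : Type*} (G : SimpleGraph V) (c : Sym2 V → ℝ)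
    (u v : V) : ℝ :=
  sInf {x | ∃ p : G.Walk u v, x = walkCost c p}

/-- The total edge cost `w(S)` of the minimal subtree `T_S` containing `S`: the
minimum total cost of a set of edges of `G` connecting `s` to every vertex of `S`. -/
noncomputable def steinerWeight {V : Type*} (G : SimpleGraph V) (c : Sym2 V → ℝ)
    (s : V) (S : Finset V) : ℝ :=
  sInf {x | ∃ E' : Finset (Sym2 V), ↑E' ⊆ G.edgeSet ∧
    (∀ v ∈ S, (SimpleGraph.fromEdgeSet (↑E' : Set (Sym2 V))).Reachable s v) ∧
    x = ∑ e ∈ E', c e}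

open SimpleGraph

section WalkCost

variable {V : Type*} {G : SimpleGraph V} (c : Sym2 V → ℝ)

lemma walkCost_nil (u : V) : walkCost c (Walk.nil : G.Walk u u) = 0 := by
  simp [walkCost]

lemma walkCost_cons {u v w : V} (h : G.Adj u v) (p : G.Walk v w) :
    walkCost c (Walk.cons h p) = c s(u, v) + walkCost c p := by
  simp [walkCost]

lemma walkCost_append {u v w : V} (p : G.Walk u v) (q : G.Walk v w) :
    walkCost c (p.append q) = walkCost c p + walkCost c q := by
  simp [walkCost]

lemma walkCost_reverse {u v : V} (p : G.Walk u v) :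
    walkCost c p.reverse = walkCost c p := by
  simp [walkCost, List.map_reverse, List.sum_reverse]

lemma walkCost_nonneg {c : Sym2 V → ℝ} (hc : ∀ e, 0 ≤ c e) {u v : V} (p : G.Walk u v) :
    0 ≤ walkCost c p := by
  apply List.sum_nonneg
  simp only [List.mem_map, forall_exists_index, and_imp]
  rintro _ e _ rfl
  exact hc e

lemma treeDist_le_walkCost {c : Sym2 V → ℝ} (hc : ∀ e, 0 ≤ c e) {u v : V} (p : G.Walk u v) :
    treeDist G c u v ≤ walkCost c p := by
  refine csInf_le ⟨0, ?_⟩ ⟨p, rfl⟩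
  rintro _ ⟨q, rfl⟩
  exact walkCost_nonneg hc q

lemma steinerWeight_le_sum {c : Sym2 V → ℝ} (hc : ∀ e, 0 ≤ c e) {s : V} {S : Finset V}
    {E' : Finset (Sym2 V)} (hE : ↑E' ⊆ G.edgeSet)
    (hS : ∀ v ∈ S, (fromEdgeSet (↑E' : Set (Sym2 V))).Reachable s v) :
    steinerWeight G c s S ≤ ∑ e ∈ E', c e := by
  refine csInf_le ⟨0, ?_⟩ ⟨E', hE, hS, rfl⟩
  rintro _ ⟨F, -, -, rfl⟩
  exact Finset.sum_nonneg fun e _ => hc e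

end WalkCost

/-- In an acyclic graph, a walk traverses an edge `s(a, b)` an even number of times exactly when
its endpoints lie on the same side of that edge. -/
lemma SimpleGraph.IsAcyclic.even_count_edges_iff {V : Type*} [DecidableEq V] {G : SimpleGraph V}
    (hG : G.IsAcyclic) {a b : V} (hab : G.Adj a b) {u v : V} (p : G.Walk u v) :
    Even (p.edges.count s(a, b)) ↔
      ((G.deleteEdges {s(a, b)}).Reachable a u ↔ (G.deleteEdges {s(a, b)}).Reachable a v) := by
  have hb : ¬ (G.deleteEdges {s(a, b)}).Reachable a b :=
    isBridge_iff.1 (isAcyclic_iff_forall_adj_isBridge.1 hG hab)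
  induction p with
  | nil => simp
  | @cons x y z h p ih =>
    rw [Walk.edges_cons, List.count_cons]
    by_cases he : s(x, y) = s(a, b)
    · have hxy : (G.deleteEdges {s(a, b)}).Reachable a x ↔
          ¬ (G.deleteEdges {s(a, b)}).Reachable a y := by
        rcases Sym2.eq_iff.1 he with ⟨rfl, rfl⟩ | ⟨rfl, rfl⟩
        · simp [hb]
        · simp [hb]
      simp only [he, beq_self_eq_true, if_true, Nat.even_add_one]
      exact (not_congr ih).trans (by tauto)
    · have hadj : (G.deleteEdges {s(a, b)}).Adj x y := by
        rw [deleteEdges_adj]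
        exact ⟨h, he⟩
      have hxy : (G.deleteEdges {s(a, b)}).Reachable a x ↔
          (G.deleteEdges {s(a, b)}).Reachable a y :=
        ⟨fun h => h.trans hadj.reachable, fun h => h.trans hadj.symm.reachable⟩
      simp only [beq_iff_eq, he, if_false, add_zero]
      exact ih.trans (by rw [hxy])

/-- A closed walk in an acyclic graph traverses each of its edges at least twice. -/
lemma SimpleGraph.IsAcyclic.two_le_count_edges {V : Type*} [DecidableEq V] {G : SimpleGraph V}
    (hG : G.IsAcyclic) {u : V} (p : G.Walk u u) {e : Sym2 V} (he : e ∈ p.edges) :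
    2 ≤ p.edges.count e := by
  induction e with
  | _ a b =>
    have heven := (hG.even_count_edges_iff (p.adj_of_mem_edges he) p).2 Iff.rfl
    have hpos := List.count_pos_iff.2 he
    obtain ⟨k, hk⟩ := heven
    omega

lemma two_mul_sum_edges_le {V : Type*} [DecidableEq V] {G : SimpleGraph V} (hG : G.IsAcyclic)
    {c : Sym2 V → ℝ} (hc : ∀ e, 0 ≤ c e) {u v : V} (p q : G.Walk u v) :
    2 * ∑ e ∈ p.edges.toFinset, c e ≤ walkCost c p + walkCost c q := by
  rw [← walkCost_reverse c q, ← walkCost_append, walkCost, Finset.sum_list_map_count,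
    Finset.mul_sum]
  refine (Finset.sum_le_sum fun e he => ?_).trans (Finset.sum_le_sum_of_subset_of_nonneg
    (s := p.edges.toFinset) ?_ fun e _ _ => nsmul_nonneg (hc e) _)
  · rw [nsmul_eq_mul]
    have he' : e ∈ (p.append q.reverse).edges := by
      simp [List.mem_toFinset.1 he]
    have h2 : (2 : ℝ) ≤ (p.append q.reverse).edges.count e := by
      exact_mod_cast hG.two_le_count_edges _ he'
    exact mul_le_mul_of_nonneg_right h2 (hc e)
  · intro e he
    simp [List.mem_toFinset.1 he]

lemma steinerWeight_le_sum_edges {V : Type*} [DecidableEq V] {G : SimpleGraph V}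
    {c : Sym2 V → ℝ} (hc : ∀ e, 0 ≤ c e) {s v : V} {S : Finset V} (p : G.Walk s v)
    (hp : ∀ u ∈ S, u ∈ p.support) :
    steinerWeight G c s S ≤ ∑ e ∈ p.edges.toFinset, c e := by
  refine steinerWeight_le_sum hc (fun e he => p.edges_subset_edgeSet (by simpa using he)) ?_
  intro u hu
  refine ⟨(p.takeUntil u (hp u hu)).transfer _ fun e he => ?_⟩
  have hep := p.edges_takeUntil_subset_edges (hp u hu) he
  rw [edgeSet_fromEdgeSet]
  exact ⟨by simpa using hep, G.not_isDiag_of_mem_edgeSet (p.edges_subset_edgeSet hep)⟩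

/-- A walk covering a set that contains its starting vertex can be truncated, at no extra cost,
to end in that set. -/
lemma exists_walk_end_mem {V : Type*} {G : SimpleGraph V} {c : Sym2 V → ℝ} (hc : ∀ e, 0 ≤ c e)
    {s v : V} {S : Finset V} (hsS : s ∈ S) (p : G.Walk s v) (hp : ∀ u ∈ S, u ∈ p.support) :
    ∃ w ∈ S, ∃ q : G.Walk s w, (∀ u ∈ S, u ∈ q.support) ∧ walkCost c q ≤ walkCost c p := by
  induction p using Walk.concatRec with
  | Hnil => exact ⟨_, hsS, Walk.nil, hp, le_rfl⟩
  | @Hconcat u v w p h ih =>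
    by_cases hw : w ∈ S
    · exact ⟨w, hw, p.concat h, hp, le_rfl⟩
    · obtain ⟨x, hx, q, hq, hle⟩ := ih hsS fun y hy => by
        have := hp y hy
        rw [Walk.support_concat, List.mem_append, List.mem_singleton] at this
        exact this.resolve_right fun h => hw (h ▸ hy)
      refine ⟨x, hx, q, hq, hle.trans ?_⟩
      rw [Walk.concat_eq_append, walkCost_append]
      linarith [walkCost_nonneg hc (Walk.cons h Walk.nil)]

/-- Inside a set `E'` of edges one can tour everything reachable from `s`, ending at any prescribed
reachable vertex `v`, so that together with a suitable second walk from `s` to `v` the total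
cost is at most twice that of `E'`. -/
lemma exists_walk_covering {V : Type*} [Fintype V] [DecidableEq V] {G : SimpleGraph V}
    {c : Sym2 V → ℝ} (hc : ∀ e, 0 ≤ c e) {s : V} {E' : Finset (Sym2 V)}
    (hE : ↑E' ⊆ G.edgeSet) {v : V} (hv : (fromEdgeSet (↑E' : Set (Sym2 V))).Reachable s v) :
    ∃ p q : G.Walk s v,
      (∀ u, (fromEdgeSet (↑E' : Set (Sym2 V))).Reachable s u → u ∈ p.support) ∧
      walkCost c p + walkCost c q ≤ 2 * ∑ e ∈ E', c e := by
  classical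
  let P : Finset V → Prop := fun R => s ∈ R ∧ ∀ v ∈ R, ∃ p q : G.Walk s v,
    (∀ u ∈ R, u ∈ p.support) ∧
    walkCost c p + walkCost c q ≤ 2 * ∑ e ∈ E' with ∀ x ∈ e, x ∈ R, c e
  have hP : P {s} := by
    refine ⟨by simp, fun v hv => ?_⟩
    obtain rfl := Finset.mem_singleton.1 hv
    refine ⟨Walk.nil, Walk.nil, by simp, ?_⟩
    rw [walkCost_nil, add_zero]
    exact mul_nonneg two_pos.le (Finset.sum_nonneg fun e _ => hc e)
  obtain ⟨R, hR, hmax⟩ := Finset.exists_max_image (Finset.univ.filter P) Finset.card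
    ⟨{s}, by simpa using hP⟩
  have hPR : P R := (Finset.mem_filter.1 hR).2
  have hclosed : ∀ a ∈ R, ∀ b, s(a, b) ∈ E' → b ∈ R := by
    intro a ha b hab
    by_contra hb
    have hadj : G.Adj a b := hE hab
    have hsum : (∑ e ∈ E' with ∀ x ∈ e, x ∈ R, c e) + c s(a, b) ≤
        ∑ e ∈ E' with ∀ x ∈ e, x ∈ insert b R, c e := by
      rw [add_comm, ← Finset.sum_insert (by simp [hb])]
      refine Finset.sum_le_sum_of_subset_of_nonneg ?_ fun e _ _ => hc e
      intro e he
      rcases Finset.mem_insert.1 he with rfl | he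
      · simp [hab, ha]
      · rw [Finset.mem_filter] at he ⊢
        exact ⟨he.1, fun x hx => Finset.mem_insert_of_mem (he.2 x hx)⟩
    have hPb : P (insert b R) := by
      refine ⟨Finset.mem_insert_of_mem hPR.1, fun v hv => ?_⟩
      rcases Finset.mem_insert.1 hv with rfl | hv
      · obtain ⟨p, q, hp, hpq⟩ := hPR.2 a ha
        refine ⟨p.append (Walk.cons hadj Walk.nil), q.append (Walk.cons hadj Walk.nil), ?_, ?_⟩
        · intro u hu
          rw [Walk.mem_support_append_iff]
          rcases Finset.mem_insert.1 hu with rfl | hu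
          · simp
          · exact Or.inl (hp u hu)
        · simp only [walkCost_append, walkCost_cons, walkCost_nil]
          linarith
      · obtain ⟨p, q, hp, hpq⟩ := hPR.2 v hv
        have hap := hp a ha
        refine ⟨(p.takeUntil a hap).append
          (Walk.cons hadj (Walk.cons hadj.symm (p.dropUntil a hap))), q, ?_, ?_⟩
        · intro u hu
          rw [Walk.mem_support_append_iff]
          rcases Finset.mem_insert.1 hu with rfl | hu
          · simp
          · have hup := hp u hu
            rw [← p.take_spec hap, Walk.mem_support_append_iff] at hup
            rcases hup with h | h
            · exact Or.inl h
            · exact Or.inr (by simp [h])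
        · have hcost := congrArg (walkCost c) (p.take_spec hap)
          rw [walkCost_append] at hcost
          simp only [walkCost_append, walkCost_cons]
          rw [Sym2.eq_swap (a := b)]
          linarith
    have := hmax (insert b R) (by simpa using hPb)
    rw [Finset.card_insert_of_notMem hb] at this
    omega
  have hreach : ∀ u, (fromEdgeSet (↑E' : Set (Sym2 V))).Reachable s u → u ∈ R := by
    rintro u ⟨p⟩
    have hs := hPR.1
    clear hPR hP hv hR hmax
    induction p with
    | nil => exact hs
    | cons h p ih => exact ih (hclosed _ hs _ (by simpa using h.1))
  obtain ⟨p, q, hp, hpq⟩ := hPR.2 v (hreach v hv)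
  refine ⟨p, q, fun u hu => hp u (hreach u hu), hpq.trans ?_⟩
  exact mul_le_mul_of_nonneg_left (Finset.sum_le_sum_of_subset_of_nonneg
    (Finset.filter_subset _ _) fun e _ _ => hc e) two_pos.le

/-- In a finite tree with root `s` and nonnegative edge costs, the minimum cost of a
walk from `s` visiting every vertex of a set `S ∋ s` equals
`2·w(S) − max_{v ∈ S} d(s, v)`. -/
theorem stmt16 {V : Type*} [Fintype V] [DecidableEq V] (G : SimpleGraph V)
    (hG : G.IsTree) (c : Sym2 V → ℝ) (hc : ∀ e, 0 ≤ c e) (s : V)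
    (S : Finset V) (hsS : s ∈ S) :
    sInf {x | ∃ (v : V) (p : G.Walk s v),
        (∀ u ∈ S, u ∈ p.support) ∧ x = walkCost c p}
      = 2 * steinerWeight G c s S - S.sup' ⟨s, hsS⟩ (fun v => treeDist G c s v) := by
  classical
  have hE : ((G.edgeFinset : Finset (Sym2 V)) : Set (Sym2 V)) ⊆ G.edgeSet := by simp
  have hconn : ∀ v, (fromEdgeSet ((G.edgeFinset : Finset (Sym2 V)) : Set (Sym2 V))).Reachable
      s v := by
    intro v
    rw [coe_edgeFinset, fromEdgeSet_edgeSet]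
    exact hG.connected.preconnected s v
  apply le_antisymm
  · obtain ⟨v, hvS, hv⟩ := S.exists_mem_eq_sup' ⟨s, hsS⟩ (fun v => treeDist G c s v)
    rw [hv, le_sub_iff_add_le, ← div_le_iff₀' two_pos]
    refine le_csInf ⟨_, G.edgeFinset, hE, fun v _ => hconn v, rfl⟩ ?_
    rintro _ ⟨E', hE', hS, rfl⟩
    obtain ⟨p, q, hp, hpq⟩ := exists_walk_covering hc hE' (hS v hvS)
    rw [div_le_iff₀' two_pos]
    refine le_trans (add_le_add (csInf_le ⟨0, ?_⟩ ⟨v, p, fun u hu => hp u (hS u hu), rfl⟩)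
      (treeDist_le_walkCost hc q)) hpq
    rintro _ ⟨w, r, -, rfl⟩
    exact walkCost_nonneg hc r
  · obtain ⟨p₀, -, hp₀, -⟩ := exists_walk_covering hc hE (hconn s)
    refine le_csInf ⟨_, s, p₀, fun u _ => hp₀ u (hconn u), rfl⟩ ?_
    rintro _ ⟨v, p, hp, rfl⟩
    obtain ⟨w, hw, q, hq, hle⟩ := exists_walk_end_mem hc hsS p hp
    have hsteiner := steinerWeight_le_sum_edges hc q hq
    have hdist : 2 * ∑ e ∈ q.edges.toFinset, c e - walkCost c q ≤ treeDist G c s w := by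
      refine le_csInf ⟨_, q, rfl⟩ ?_
      rintro _ ⟨r, rfl⟩
      linarith [two_mul_sum_edges_le hG.isAcyclic hc q r]
    have hsup : treeDist G c s w ≤ S.sup' ⟨s, hsS⟩ (fun v => treeDist G c s v) :=
      S.le_sup' (fun v => treeDist G c s v) hw
    linarith
end

section
/- Let V be a finite set with |V| = n ≥ 1, let π : V → ℝ be nonnegative, and let F be a nonempty family of subsets of V. Let OPT = max_{S ∈ F} Σ_{v ∈ S} π(v), and let π_max > 0 satisfy π(v) ≤ π_max for all v ∈ V and π_max ≤ OPT. Define π'(v) = ⌊n²·π(v)/π_max⌋ + 1. If S' ∈ F maximizes Σ_{v ∈ S} π'(v) over all S ∈ F, then Σ_{v ∈ S'} π(v) ≥ (1 − 1/n)·OPT. -/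
/-- Profit-rounding lemma. Let `V` be a finite set with `n = |V| ≥ 1` elements,
`π : V → ℝ` nonnegative, `F` a nonempty family of subsets of `V`,
`OPT = max_{S ∈ F} π(S)`, and `π_max > 0` with `π v ≤ π_max` for all `v` and
`π_max ≤ OPT`. Round the profits to `π' v = ⌊n²·π v / π_max⌋ + 1`. Then any
`S' ∈ F` maximizing `π'` over `F` satisfies `π(S') ≥ (1 - 1/n)·OPT`. -/
theorem stmt18 {V : Type*} [Fintype V] [DecidableEq V] (n : ℕ) (hn : 1 ≤ n)
    (hcard : Fintype.card V = n)
    (π : V → ℝ) (hπ : ∀ v, 0 ≤ π v)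
    (F : Finset (Finset V)) (hF : F.Nonempty)
    (OPT : ℝ) (hOPT : OPT = F.sup' hF (fun S => ∑ v ∈ S, π v))
    (πmax : ℝ) (hπmax : 0 < πmax) (hle : ∀ v, π v ≤ πmax) (hπOPT : πmax ≤ OPT)
    (π' : V → ℝ) (hπ' : ∀ v, π' v = (⌊(n : ℝ) ^ 2 * π v / πmax⌋ : ℝ) + 1)
    (S' : Finset V) (hS' : S' ∈ F)
    (hmax : ∀ S ∈ F, ∑ v ∈ S, π' v ≤ ∑ v ∈ S', π' v) :
    (1 - 1 / (n : ℝ)) * OPT ≤ ∑ v ∈ S', π v := by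
  obtain ⟨S, hS, hSOPT⟩ := F.exists_mem_eq_sup' hF (fun S => ∑ v ∈ S, π v)
  rw [← hOPT] at hSOPT
  have hn0 : (0 : ℝ) < n := by exact_mod_cast hn
  have hlower : (n : ℝ) ^ 2 / πmax * OPT ≤ ∑ v ∈ S, π' v := by
    rw [hSOPT, Finset.mul_sum]
    refine Finset.sum_le_sum fun v _ => ?_
    rw [hπ', div_mul_eq_mul_div]
    exact (Int.lt_floor_add_one _).le
  have hupper : ∑ v ∈ S', π' v ≤ (n : ℝ) ^ 2 / πmax * ∑ v ∈ S', π v + n := by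
    have hcardS' : (S'.card : ℝ) ≤ n := by
      exact_mod_cast hcard ▸ Finset.card_le_univ S'
    calc ∑ v ∈ S', π' v ≤ ∑ v ∈ S', ((n : ℝ) ^ 2 / πmax * π v + 1) := by
          refine Finset.sum_le_sum fun v _ => ?_
          rw [hπ', div_mul_eq_mul_div]
          gcongr
          exact Int.floor_le _
      _ = (n : ℝ) ^ 2 / πmax * ∑ v ∈ S', π v + S'.card := by
          simp [Finset.sum_add_distrib, Finset.mul_sum]
      _ ≤ _ := by gcongr
  have hscaled : (n : ℝ) ^ 2 / πmax * OPT ≤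
      (n : ℝ) ^ 2 / πmax * (∑ v ∈ S', π v + πmax / n) := by
    have hscale : (n : ℝ) ^ 2 / πmax * (πmax / n) = n := by field_simp
    rw [mul_add, hscale]
    exact hlower.trans ((hmax S hS).trans hupper)
  have hadditive : OPT ≤ ∑ v ∈ S', π v + πmax / n :=
    le_of_mul_le_mul_left hscaled (by positivity)
  have herror : πmax / n ≤ OPT / n := by gcongr
  calc (1 - 1 / (n : ℝ)) * OPT = OPT - OPT / n := by ring
    _ ≤ ∑ v ∈ S', π v := by linarith
end
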